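/- For all x in [0,1], all positive integers n, 0<q<1, and 0 ≤ α ≤ β, the first central moment of the q-Durrmeyer–Stancu operator satisfies D_{n,q}^{α,β}(t − x; x) = (q[n]_q²/([n+2]_q([n]_q+β)) − 1) x + ([n]_q + α[n+2]_q)/([n+2]_q([n]_q+β)). -/

import Mathlib

open Finset Filter Topology

/-- The q-integer `[n]_q = 1 + q + ⋯ + q^(n-1)`. -/
noncomputable def qInt (q : ℝ) (n : ℕ) : ℝ := ∑ i ∈ Finset.range n, q ^ i

/-- The q-factorial `[n]_q!`. -/
noncomputable def qFact (q : ℝ) (n : ℕ) : ℝ := ∏ i ∈ Finset.range n, qInt q (i + 1)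

/-- The q-binomial coefficient. -/
noncomputable def qBinom (q : ℝ) (n k : ℕ) : ℝ := qFact q n / (qFact q k * qFact q (n - k))

/-- `(1 - x)_q^n = ∏_{j=0}^{n-1} (1 - q^j x)`. -/
noncomputable def qOneSubPow (q x : ℝ) (n : ℕ) : ℝ := ∏ j ∈ Finset.range n, (1 - q ^ j * x)

/-- The q-Bernstein basis `p_{nk}(q;x)`. -/
noncomputable def qBern (q : ℝ) (n k : ℕ) (x : ℝ) : ℝ :=
  qBinom q n k * x ^ k * qOneSubPow q x (n - k)

/-- The Jackson q-integral on `[0,1]`. -/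
noncomputable def qIntegral (q : ℝ) (g : ℝ → ℝ) : ℝ := (1 - q) * ∑' j : ℕ, q ^ j * g (q ^ j)

/-- The q-Durrmeyer operator `D_{n,q}(f;x)`. -/
noncomputable def qDurrmeyer (q : ℝ) (n : ℕ) (f : ℝ → ℝ) (x : ℝ) : ℝ :=
  qInt q (n + 1) * ∑ k ∈ Finset.range (n + 1),
    q ^ (-(k : ℤ)) * qBern q n k x * qIntegral q (fun t => f t * qBern q n k (q * t))

/-- The q-Durrmeyer–Stancu operator `D_{n,q}^{α,β}(f;x)`. -/
noncomputable def qDurrmeyerStancu (q : ℝ) (n : ℕ) (α β : ℝ) (f : ℝ → ℝ) (x : ℝ) : ℝ :=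
  qDurrmeyer q n (fun t => f ((qInt q n * t + α) / (qInt q n + β))) x

/-- The q-derivative `D_q f(x) = (f(qx) - f(x)) / ((q-1)x)`. -/
noncomputable def qDeriv (q : ℝ) (f : ℝ → ℝ) (x : ℝ) : ℝ := (f (q * x) - f x) / ((q - 1) * x)

/-- The q-power `(t - x)_q^m = ∏_{j=0}^{m-1} (t - q^j x)`, as a function of `t`. -/
noncomputable def qCentral (q x : ℝ) (m : ℕ) (t : ℝ) : ℝ := ∏ j ∈ Finset.range m, (t - q ^ j * x)

theorem qInt_succ_eq_one_add (q : ℝ) (n : ℕ) : qInt q (n + 1) = 1 + q * qInt q n := by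
  simp [qInt, Finset.sum_range_succ', Finset.mul_sum, pow_succ', add_comm]

theorem qInt_add (q : ℝ) (m n : ℕ) : qInt q (m + n) = qInt q m + q ^ m * qInt q n := by
  simp [qInt, Finset.sum_range_add, Finset.mul_sum, pow_add]

theorem qInt_pos {q : ℝ} (hq : 0 < q) {n : ℕ} (hn : 0 < n) : 0 < qInt q n :=
  Finset.sum_pos (fun _ _ => pow_pos hq _) (Finset.nonempty_range_iff.2 hn.ne')

theorem one_sub_mul_qInt (q : ℝ) (n : ℕ) : (1 - q) * qInt q n = 1 - q ^ n :=
  mul_neg_geom_sum q n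

theorem qFact_succ (q : ℝ) (n : ℕ) : qFact q (n + 1) = qFact q n * qInt q (n + 1) := by
  simp [qFact, Finset.prod_range_succ]

theorem qFact_pos {q : ℝ} (hq : 0 < q) (n : ℕ) : 0 < qFact q n :=
  Finset.prod_pos fun i _ => qInt_pos hq i.succ_pos

theorem qOneSubPow_succ (q x : ℝ) (n : ℕ) :
    qOneSubPow q x (n + 1) = qOneSubPow q x n * (1 - q ^ n * x) := by
  simp [qOneSubPow, Finset.prod_range_succ]

/-- The `q`-beta integral, as a convergent series. -/
theorem hasSum_qBeta {q : ℝ} (hq0 : 0 < q) (hq1 : q < 1) (a b : ℕ) :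
    HasSum (fun j : ℕ => (1 - q) * (q ^ j * ((q ^ j) ^ a * qOneSubPow q (q * q ^ j) b)))
      (qFact q a * qFact q b / qFact q (a + b + 1)) := by
  induction b generalizing a with
  | zero =>
    have hlt : q ^ (a + 1) < 1 := pow_lt_one₀ hq0.le hq1 a.succ_ne_zero
    have h := (hasSum_geometric_of_lt_one (pow_pos hq0 (a + 1)).le hlt).mul_left (1 - q)
    refine Eq.mpr (congrArg₂ (fun f s => HasSum f s) ?_ ?_) h
    · funext j
      simp only [qOneSubPow, Finset.range_zero, Finset.prod_empty, mul_one]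
      ring
    · have h1 := one_sub_mul_qInt q (a + 1)
      have h2 := (qFact_pos hq0 a).ne'
      have h3 := (qInt_pos hq0 a.succ_pos).ne'
      have h4 : 1 - q ≠ 0 := by linarith
      rw [← h1, Nat.add_zero, qFact_succ]
      simp only [Nat.succ_eq_add_one] at h3
      simp only [qFact, Finset.range_zero, Finset.prod_empty] at h2 ⊢
      field_simp
  | succ b ih =>
    have h := (ih a).sub ((ih (a + 1)).mul_left (q ^ (b + 1)))
    refine Eq.mpr (congrArg₂ (fun f s => HasSum f s) ?_ ?_) h
    · funext j
      rw [qOneSubPow_succ]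
      ring
    · have h1 := (qFact_pos hq0 (a + b + 1)).ne'
      have h2 := (qInt_pos hq0 (a + b + 1).succ_pos).ne'
      have h3 := qInt_add q (b + 1) (a + 1)
      rw [show b + 1 + (a + 1) = a + b + 1 + 1 by ring] at h3
      rw [show a + (b + 1) + 1 = a + b + 1 + 1 by ring,
        show a + 1 + b + 1 = a + b + 1 + 1 by ring, qFact_succ q (a + b + 1), qFact_succ q a,
        qFact_succ q b]
      simp only [Nat.succ_eq_add_one] at h2
      field_simp
      rw [h3]
      ring

theorem qBern_mul_left (q : ℝ) (n k : ℕ) (t : ℝ) :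
    qBern q n k (q * t) = qBinom q n k * q ^ k * (t ^ k * qOneSubPow q (q * t) (n - k)) := by
  rw [qBern, mul_pow]
  ring

/-- The Jackson integral of an affine function against a shifted `q`-Bernstein polynomial. -/
theorem qIntegral_affine_mul_qBern {q : ℝ} (hq0 : 0 < q) (hq1 : q < 1) {n k : ℕ} (hk : k ≤ n)
    (c d : ℝ) :
    qInt q (n + 1) * (q ^ (-(k : ℤ)) * qIntegral q (fun t => (c * t + d) * qBern q n k (q * t))) =
      c * (qInt q (k + 1) / qInt q (n + 2)) + d := by
  have h := (((hasSum_qBeta hq0 hq1 (k + 1) (n - k)).mul_left c).add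
    ((hasSum_qBeta hq0 hq1 k (n - k)).mul_left d)).mul_left (qBinom q n k * q ^ k)
  have hI : qIntegral q (fun t => (c * t + d) * qBern q n k (q * t)) =
      qBinom q n k * q ^ k *
        (c * (qFact q (k + 1) * qFact q (n - k) / qFact q (k + 1 + (n - k) + 1)) +
          d * (qFact q k * qFact q (n - k) / qFact q (k + (n - k) + 1))) := by
    rw [← h.tsum_eq, qIntegral, ← tsum_mul_left]
    refine tsum_congr fun j => ?_
    rw [qBern_mul_left]
    ring
  rw [hI, zpow_neg, zpow_natCast, qBinom, show k + 1 + (n - k) + 1 = n + 1 + 1 by omega,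
    show k + (n - k) + 1 = n + 1 by omega, qFact_succ q (n + 1), qFact_succ q n, qFact_succ q k]
  have h1 := (qFact_pos hq0 n).ne'
  have h2 := (qFact_pos hq0 k).ne'
  have h3 := (qFact_pos hq0 (n - k)).ne'
  have h4 : qInt q (n + 1) ≠ 0 := (qInt_pos hq0 n.succ_pos).ne'
  have h5 : qInt q (n + 1 + 1) ≠ 0 := (qInt_pos hq0 (n + 1).succ_pos).ne'
  field_simp

theorem qBern_succ_zero {q : ℝ} (hq : 0 < q) (n : ℕ) (x : ℝ) :
    qBern q (n + 1) 0 x = qBern q n 0 x * (1 - q ^ n * x) := by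
  have h1 := (qFact_pos hq n).ne'
  have h2 := (qFact_pos hq (n + 1)).ne'
  have h3 : qFact q 0 = 1 := by simp [qFact]
  simp only [qBern, qBinom, Nat.sub_zero, qOneSubPow_succ, h3]
  field_simp

theorem qBern_self {q : ℝ} (hq : 0 < q) (n : ℕ) (x : ℝ) : qBern q n n x = x ^ n := by
  have h1 := (qFact_pos hq n).ne'
  simp [qBern, qBinom, qOneSubPow, qFact] at h1 ⊢
  field_simp

/-- The degree-raising recurrence of the `q`-Bernstein basis. -/
theorem qBern_succ_succ {q : ℝ} (hq : 0 < q) {n k : ℕ} (hk : k < n) (x : ℝ) :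
    qBern q (n + 1) (k + 1) x =
      qBern q n (k + 1) x * (1 - q ^ (n - (k + 1)) * x) + q ^ (n - k) * x * qBern q n k x := by
  obtain ⟨b, rfl⟩ := Nat.exists_eq_add_of_lt hk
  simp only [qBern, qBinom, show k + b + 1 + 1 - (k + 1) = b + 1 by omega,
    show k + b + 1 - (k + 1) = b by omega, show k + b + 1 - k = b + 1 by omega,
    qOneSubPow_succ, qFact_succ q (k + b + 1), qFact_succ q k, qFact_succ q b]
  have h1 := (qFact_pos hq k).ne'
  have h2 := (qFact_pos hq b).ne'
  have h3 : qInt q (k + 1) ≠ 0 := (qInt_pos hq k.succ_pos).ne'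
  have h4 : qInt q (b + 1) ≠ 0 := (qInt_pos hq b.succ_pos).ne'
  have h5 := qInt_add q (b + 1) (k + 1)
  rw [show b + 1 + (k + 1) = k + b + 1 + 1 by ring] at h5
  rw [h5]
  field_simp
  ring

theorem sum_qBern_succ_partial {q : ℝ} (hq : 0 < q) {n m : ℕ} (hm : m ≤ n) (x : ℝ) :
    ∑ k ∈ Finset.range (m + 1), qBern q (n + 1) k x =
      ∑ k ∈ Finset.range (m + 1), qBern q n k x - q ^ (n - m) * x * qBern q n m x := by
  induction m with
  | zero =>
    simp [qBern_succ_zero hq]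
    ring
  | succ m ih =>
    rw [Finset.sum_range_succ, ih (by omega), qBern_succ_succ hq hm,
      Finset.sum_range_succ (fun k => qBern q n k x) (m + 1)]
    ring

/-- The `q`-Bernstein basis is a partition of unity. -/
theorem sum_qBern {q : ℝ} (hq : 0 < q) (n : ℕ) (x : ℝ) :
    ∑ k ∈ Finset.range (n + 1), qBern q n k x = 1 := by
  induction n with
  | zero => simp [qBern_self hq]
  | succ n ih =>
    rw [Finset.sum_range_succ, sum_qBern_succ_partial hq le_rfl, ih, qBern_self hq, qBern_self hq]
    simp only [Nat.sub_self]
    ring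

theorem qInt_mul_qBern_succ_succ {q : ℝ} (hq : 0 < q) (n k : ℕ) (x : ℝ) :
    qInt q (k + 1) * qBern q (n + 1) (k + 1) x = qInt q (n + 1) * x * qBern q n k x := by
  simp only [qBern, qBinom, Nat.add_sub_add_right, qFact_succ]
  have h1 := (qFact_pos hq k).ne'
  have h2 := (qFact_pos hq (n - k)).ne'
  have h3 : qInt q (k + 1) ≠ 0 := (qInt_pos hq k.succ_pos).ne'
  field_simp
  ring

theorem sum_qInt_mul_qBern {q : ℝ} (hq : 0 < q) (n : ℕ) (x : ℝ) :
    ∑ k ∈ Finset.range (n + 1), qInt q k * qBern q n k x = qInt q n * x := by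
  cases n with
  | zero => simp [qInt]
  | succ n =>
    rw [Finset.sum_range_succ', Finset.sum_congr rfl fun k _ => qInt_mul_qBern_succ_succ hq n k x,
      ← Finset.mul_sum, sum_qBern hq]
    simp [qInt]

/-- The `q`-Durrmeyer operator on affine functions. -/
theorem qDurrmeyer_affine {q : ℝ} (hq0 : 0 < q) (hq1 : q < 1) (n : ℕ) (c d x : ℝ) :
    qDurrmeyer q n (fun t => c * t + d) x =
      c * ((1 + q * qInt q n * x) / qInt q (n + 2)) + d := by
  have hterm : ∀ k ∈ Finset.range (n + 1),
      qInt q (n + 1) * (q ^ (-(k : ℤ)) * qBern q n k x *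
        qIntegral q (fun t => (c * t + d) * qBern q n k (q * t))) =
      (c / qInt q (n + 2) + d) * qBern q n k x +
        c * q / qInt q (n + 2) * (qInt q k * qBern q n k x) := by
    intro k hk
    have h := qIntegral_affine_mul_qBern hq0 hq1 (Finset.mem_range_succ_iff.1 hk) c d
    rw [qInt_succ_eq_one_add q k] at h
    linear_combination qBern q n k x * h
  rw [qDurrmeyer, Finset.mul_sum, Finset.sum_congr rfl hterm, Finset.sum_add_distrib,
    ← Finset.mul_sum, ← Finset.mul_sum, sum_qBern hq0, sum_qInt_mul_qBern hq0]
  ring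

/-- First central moment of the q-Durrmeyer–Stancu operator. -/
theorem qDurrmeyerStancu_first_central_moment (q x α β : ℝ) (hq0 : 0 < q) (hq1 : q < 1)
    (hα : 0 ≤ α) (hαβ : α ≤ β) (n : ℕ) (hn : 0 < n) (hx : x ∈ Set.Icc (0 : ℝ) 1) :
    qDurrmeyerStancu q n α β (fun t => t - x) x =
      (q * qInt q n ^ 2 / (qInt q (n + 2) * (qInt q n + β)) - 1) * x +
        (qInt q n + α * qInt q (n + 2)) / (qInt q (n + 2) * (qInt q n + β)) := by
  have h1 : 0 < qInt q n := qInt_pos hq0 hn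
  have h2 : qInt q (n + 2) ≠ 0 := (qInt_pos hq0 (n + 1).succ_pos).ne'
  have h3 : qInt q n + β ≠ 0 := by linarith
  have hf : (fun t : ℝ => (qInt q n * t + α) / (qInt q n + β) - x) =
      fun t => qInt q n / (qInt q n + β) * t + (α / (qInt q n + β) - x) := by
    funext t
    ring
  rw [qDurrmeyerStancu, hf, qDurrmeyer_affine hq0 hq1]
  field_simp
  ring
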